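/- arXiv:2411.11711 — 3 statements merged into one kernel-verified Lean document; each statement's English description precedes it below -/
import Mathlib

section
/- Let v_tet = 3·Λ(π/3), where Λ(θ) = -∫_0^θ log(2 sin t) dt. Then 1.014941 < v_tet < 1.014942. -/
/-- The Lobachevsky function `Λ(θ) = -∫_0^θ log (2 sin t) dt`. -/
noncomputable def lob (θ : ℝ) : ℝ := -∫ t in (0:ℝ)..θ, Real.log (2 * Real.sin t)

/-- The volume of the regular ideal hyperbolic tetrahedron. -/
noncomputable def vtet : ℝ := 3 * lob (Real.pi / 3)

/-- The Taylor polynomial of the sine at `0` with `n` nonzero terms. -/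
noncomputable def sinTaylor (n : ℕ) (x : ℝ) : ℝ :=
  ∑ i ∈ Finset.range n, (-1) ^ i * x ^ (2 * i + 1) / (2 * i + 1).factorial

/-- The Taylor polynomial of the cosine at `0` with `n` nonzero terms. -/
noncomputable def cosTaylor (n : ℕ) (x : ℝ) : ℝ :=
  ∑ i ∈ Finset.range n, (-1) ^ i * x ^ (2 * i) / (2 * i).factorial

theorem hasDerivAt_sinTaylor (n : ℕ) (x : ℝ) :
    HasDerivAt (sinTaylor n) (cosTaylor n x) x := by
  unfold sinTaylor cosTaylor
  refine HasDerivAt.fun_sum fun i _ => ?_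
  convert! ((hasDerivAt_pow (2 * i + 1) x).const_mul ((-1 : ℝ) ^ i)).div_const
    ((2 * i + 1).factorial : ℝ) using 1
  rw [Nat.factorial_succ]
  push_cast
  have := Nat.cast_ne_zero (R := ℝ).2 (2 * i).factorial_ne_zero
  field_simp

theorem hasDerivAt_cosTaylor (n : ℕ) (x : ℝ) :
    HasDerivAt (cosTaylor (n + 1)) (-sinTaylor n x) x := by
  have h : cosTaylor (n + 1) = fun x => (∑ i ∈ Finset.range n,
      (-1 : ℝ) ^ (i + 1) * x ^ (2 * i + 1 + 1) / (2 * i + 1 + 1).factorial) + 1 := by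
    funext x
    simp [cosTaylor, Finset.sum_range_succ', mul_add]
  rw [h, sinTaylor, ← Finset.sum_neg_distrib]
  refine (HasDerivAt.fun_sum fun i _ => ?_).add_const 1
  convert! ((hasDerivAt_pow (2 * i + 1 + 1) x).const_mul ((-1 : ℝ) ^ (i + 1))).div_const
    ((2 * i + 1 + 1).factorial : ℝ) using 1
  rw [Nat.factorial_succ (2 * i + 1)]
  push_cast
  have := Nat.cast_ne_zero (R := ℝ).2 (2 * i + 1).factorial_ne_zero
  field_simp
  ring

theorem nonneg_of_hasDerivAt_nonneg {f f' : ℝ → ℝ} (hf : ∀ x, HasDerivAt f (f' x) x)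
    (h0 : f 0 = 0) (hf' : ∀ x, 0 ≤ x → 0 ≤ f' x) {x : ℝ} (hx : 0 ≤ x) : 0 ≤ f x := by
  have hmono : MonotoneOn f (Set.Ici 0) := by
    refine monotoneOn_of_hasDerivWithinAt_nonneg (convex_Ici 0)
      (fun y _ => (hf y).continuousAt.continuousWithinAt)
      (fun y _ => (hf y).hasDerivWithinAt) fun y hy => hf' y ?_
    rw [interior_Ici] at hy
    exact le_of_lt hy
  simpa [h0] using hmono Set.self_mem_Ici hx hx

theorem sinTaylor_alternates_of_cosTaylor_alternates {n : ℕ}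
    (h : ∀ x : ℝ, 0 ≤ x → 0 ≤ (-1) ^ n * (Real.cos x - cosTaylor n x)) {x : ℝ} (hx : 0 ≤ x) :
    0 ≤ (-1) ^ n * (Real.sin x - sinTaylor n x) :=
  nonneg_of_hasDerivAt_nonneg
    (fun y => ((Real.hasDerivAt_sin y).sub (hasDerivAt_sinTaylor n y)).const_mul ((-1) ^ n))
    (by simp [sinTaylor]) h hx

theorem cosTaylor_alternates (n : ℕ) {x : ℝ} (hx : 0 ≤ x) :
    0 ≤ (-1) ^ (n + 1) * (Real.cos x - cosTaylor (n + 1) x) := by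
  induction n generalizing x with
  | zero => simpa [cosTaylor] using Real.cos_le_one x
  | succ n ih =>
    refine nonneg_of_hasDerivAt_nonneg
      (fun y => ((Real.hasDerivAt_cos y).sub (hasDerivAt_cosTaylor (n + 1) y)).const_mul
        ((-1) ^ (n + 1 + 1))) (by simp [cosTaylor, Finset.sum_range_succ']) (fun y hy => ?_) hx
    have := sinTaylor_alternates_of_cosTaylor_alternates (fun z hz => ih hz) hy
    rw [pow_succ]
    linarith

theorem sinTaylor_alternates (n : ℕ) {x : ℝ} (hx : 0 ≤ x) :
    0 ≤ (-1) ^ (n + 1) * (Real.sin x - sinTaylor (n + 1) x) :=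
  sinTaylor_alternates_of_cosTaylor_alternates (fun _ hy => cosTaylor_alternates n hy) hx

/-- `t cot t`, extended by its value `1` at `t = 0`. -/
noncomputable def mulCot (t : ℝ) : ℝ := Real.cos t / Real.sinc t

/-- The even polynomial of degree `12` that agrees with the Taylor polynomial of `t cot t` up to
order `10` and has coefficient `-c` in degree `12`. -/
noncomputable def mulCotPoly (c t : ℝ) : ℝ :=
  1 - t ^ 2 / 3 - t ^ 4 / 45 - 2 * t ^ 6 / 945 - t ^ 8 / 4725 - 2 * t ^ 10 / 93555 - c * t ^ 12

/-- The antiderivative of `mulCotPoly c` vanishing at `0`. -/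
noncomputable def mulCotPolyPrimitive (c t : ℝ) : ℝ :=
  t - t ^ 3 / 9 - t ^ 5 / 225 - 2 * t ^ 7 / 6615 - t ^ 9 / 42525 - 2 * t ^ 11 / 1029105
    - c * t ^ 13 / 13

theorem sinc_pos {t : ℝ} (h0 : 0 ≤ t) (hpi : t < Real.pi) : 0 < Real.sinc t := by
  rcases h0.eq_or_lt with rfl | h
  · simp
  · rw [Real.sinc_of_ne_zero h.ne']
    exact div_pos (Real.sin_pos_of_pos_of_lt_pi h hpi) h

theorem mulCot_zero : mulCot 0 = 1 := by simp [mulCot]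

theorem mulCot_of_pos {t : ℝ} (h : 0 < t) : mulCot t = t * Real.cos t / Real.sin t := by
  rw [mulCot, Real.sinc_of_ne_zero h.ne', div_div_eq_mul_div, mul_comm]

theorem continuousOn_mulCot {θ : ℝ} (hθ : θ < Real.pi) :
    ContinuousOn mulCot (Set.Icc 0 θ) :=
  Real.continuous_cos.continuousOn.div Real.continuous_sinc.continuousOn
    fun _ ht => (sinc_pos ht.1 (ht.2.trans_lt hθ)).ne'

theorem mulCotPoly_nonneg {c t : ℝ} (hc : c ≤ 1 / 10 ^ 5) (h1 : t ^ 2 ≤ 11 / 10) :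
    0 ≤ mulCotPoly c t := by
  have hpow (n : ℕ) : t ^ (2 * n) ≤ (11 / 10) ^ n := by
    rw [pow_mul]
    exact pow_le_pow_left₀ (sq_nonneg t) h1 n
  have h12 : c * t ^ 12 ≤ 1 / 10 ^ 5 * t ^ 12 := by gcongr
  have h2 := hpow 2
  have h3 := hpow 3
  have h4 := hpow 4
  have h5 := hpow 5
  have h6 := hpow 6
  unfold mulCotPoly
  norm_num at h2 h3 h4 h5 h6
  linarith

theorem pow_add_two_le {t : ℝ} (h0 : 0 ≤ t) (h1 : t ^ 2 ≤ 11 / 10) (n : ℕ) :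
    t ^ (n + 2) ≤ 11 / 10 * t ^ n := by
  rw [pow_add, mul_comm]
  gcongr

theorem mulCot_le {t : ℝ} (h0 : 0 ≤ t) (h1 : t ^ 2 ≤ 11 / 10) (hpi : t < Real.pi) :
    mulCot t ≤ mulCotPoly (1382 / 638512875) t := by
  rcases h0.eq_or_lt with rfl | h
  · simp [mulCot_zero, mulCotPoly]
  rw [mulCot_of_pos h, div_le_iff₀ (Real.sin_pos_of_pos_of_lt_pi h hpi)]
  have hs := sinTaylor_alternates 7 h0
  have hc := cosTaylor_alternates 6 h0
  norm_num at hs hc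
  have hS : sinTaylor 8 t ≤ Real.sin t := by linarith
  have hC : Real.cos t ≤ cosTaylor 7 t := by linarith
  refine (mul_le_mul_of_nonneg_left hC h0).trans (le_trans ?_
    (mul_le_mul_of_nonneg_left hS (mulCotPoly_nonneg (by norm_num) h1)))
  have p15 := pow_add_two_le h0 h1 15
  have p19 := pow_add_two_le h0 h1 19
  have p23 := pow_add_two_le h0 h1 23
  have n15 : 0 ≤ t ^ 15 := by positivity
  have n19 : 0 ≤ t ^ 19 := by positivity
  have n23 : 0 ≤ t ^ 23 := by positivity
  have n27 : 0 ≤ t ^ 27 := by positivity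
  norm_num [sinTaylor, cosTaylor, mulCotPoly, Finset.sum_range_succ, Nat.factorial]
  linarith

theorem le_mulCot {t : ℝ} (h0 : 0 ≤ t) (h1 : t ^ 2 ≤ 11 / 10) (hpi : t < Real.pi) :
    mulCotPoly (26 / 10 ^ 7) t ≤ mulCot t := by
  rcases h0.eq_or_lt with rfl | h
  · simp [mulCot_zero, mulCotPoly]
  rw [mulCot_of_pos h, le_div_iff₀ (Real.sin_pos_of_pos_of_lt_pi h hpi)]
  have hs := sinTaylor_alternates 6 h0
  have hc := cosTaylor_alternates 5 h0
  norm_num at hs hc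
  have hS : Real.sin t ≤ sinTaylor 7 t := by linarith
  have hC : cosTaylor 6 t ≤ Real.cos t := by linarith
  refine (mul_le_mul_of_nonneg_left hS (mulCotPoly_nonneg (by norm_num) h1)).trans
    (le_trans ?_ (mul_le_mul_of_nonneg_left hC h0))
  have p13 := pow_add_two_le h0 h1 13
  have p17 := pow_add_two_le h0 h1 17
  have p21 := pow_add_two_le h0 h1 21
  have n13 : 0 ≤ t ^ 13 := by positivity
  have n17 : 0 ≤ t ^ 17 := by positivity
  have n21 : 0 ≤ t ^ 21 := by positivity
  have n25 : 0 ≤ t ^ 25 := by positivity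
  norm_num [sinTaylor, cosTaylor, mulCotPoly, Finset.sum_range_succ, Nat.factorial]
  linarith

theorem integral_mulCotPoly (c θ : ℝ) :
    ∫ t in (0:ℝ)..θ, mulCotPoly c t = mulCotPolyPrimitive c θ := by
  have hderiv (t : ℝ) : HasDerivAt (mulCotPolyPrimitive c) (mulCotPoly c t) t := by
    unfold mulCotPolyPrimitive
    convert! (((((((hasDerivAt_id t).sub ((hasDerivAt_pow 3 t).div_const 9)).sub
      ((hasDerivAt_pow 5 t).div_const 225)).sub
      (((hasDerivAt_pow 7 t).const_mul 2).div_const 6615)).sub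
      ((hasDerivAt_pow 9 t).div_const 42525)).sub
      (((hasDerivAt_pow 11 t).const_mul 2).div_const 1029105)).sub
      (((hasDerivAt_pow 13 t).const_mul c).div_const 13)) using 1
    simp only [mulCotPoly]
    push_cast
    ring
  have hcont : Continuous (mulCotPoly c) := by
    unfold mulCotPoly
    fun_prop
  rw [intervalIntegral.integral_eq_sub_of_hasDerivAt (fun t _ => hderiv t)
    (hcont.intervalIntegrable _ _)]
  simp [mulCotPolyPrimitive]

theorem intervalIntegrable_mulCot {θ : ℝ} (h0 : 0 ≤ θ) (hθ : θ < Real.pi) :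
    IntervalIntegrable mulCot MeasureTheory.volume 0 θ :=
  ContinuousOn.intervalIntegrable (by rw [Set.uIcc_of_le h0]; exact continuousOn_mulCot hθ)

theorem intervalIntegrable_log_two_mul_sin {θ : ℝ} (h0 : 0 ≤ θ) (hθ : θ < Real.pi) :
    IntervalIntegrable (fun t => Real.log (2 * Real.sin t)) MeasureTheory.volume 0 θ := by
  refine ((intervalIntegrable_const (c := Real.log 2)).add
    (intervalIntegrable_log_sin (a := 0) (b := θ))).congr ?_
  intro t ht
  rw [Set.uIoc_of_le h0] at ht
  exact (Real.log_mul two_ne_zero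
    (Real.sin_pos_of_pos_of_lt_pi ht.1 (ht.2.trans_lt hθ)).ne').symm

theorem continuousOn_mul_log_two_mul_sin {θ : ℝ} (hθ : θ < Real.pi) :
    ContinuousOn (fun t => t * Real.log (2 * Real.sin t)) (Set.Icc 0 θ) := by
  have hpos (t : ℝ) (ht : t ∈ Set.Icc 0 θ) : 2 * Real.sinc t ≠ 0 :=
    mul_ne_zero two_ne_zero (sinc_pos ht.1 (ht.2.trans_lt hθ)).ne'
  have hcont : ContinuousOn (fun t => t * Real.log t + t * Real.log (2 * Real.sinc t))
      (Set.Icc 0 θ) :=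
    Real.continuous_mul_log.continuousOn.add (continuousOn_id.mul
      ((Real.continuous_sinc.const_mul 2).continuousOn.log hpos))
  refine hcont.congr fun t ht => ?_
  rcases ht.1.eq_or_lt with rfl | h
  · simp
  · have h2 := hpos t ht
    simp only
    rw [← mul_add, ← Real.log_mul h.ne' h2, Real.sinc_of_ne_zero h.ne']
    congr 2
    field_simp

theorem lob_eq_integral_mulCot {θ : ℝ} (h0 : 0 ≤ θ) (hθ : θ < Real.pi) :
    lob θ = (∫ t in (0:ℝ)..θ, mulCot t) - θ * Real.log (2 * Real.sin θ) := by
  have hderiv (t : ℝ) (ht : t ∈ Set.Ioo 0 θ) :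
      HasDerivAt (fun t => t * Real.log (2 * Real.sin t))
        (Real.log (2 * Real.sin t) + mulCot t) t := by
    have hs := (Real.sin_pos_of_pos_of_lt_pi ht.1 (ht.2.trans hθ)).ne'
    convert! (hasDerivAt_id t).mul
      (((Real.hasDerivAt_sin t).const_mul 2).log (mul_ne_zero two_ne_zero hs)) using 1
    rw [mulCot_of_pos ht.1]
    simp only [id]
    field_simp
  have hlog := intervalIntegrable_log_two_mul_sin h0 hθ
  have hcot := intervalIntegrable_mulCot h0 hθ
  have key := intervalIntegral.integral_eq_sub_of_hasDerivAt_of_le h0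
    (continuousOn_mul_log_two_mul_sin hθ) hderiv (hlog.add hcot)
  rw [intervalIntegral.integral_add hlog hcot] at key
  rw [lob]
  linarith

theorem vtet_eq :
    vtet = 3 * (∫ t in (0:ℝ)..Real.pi / 3, mulCot t) - Real.pi / 2 * Real.log 3 := by
  have hpi := Real.pi_pos
  rw [vtet, lob_eq_integral_mulCot (by positivity) (by linarith), Real.sin_pi_div_three,
    mul_div_cancel₀ _ two_ne_zero, Real.log_sqrt (by norm_num)]
  ring

theorem mulCotPolyPrimitive_le_integral_mulCot {θ : ℝ} (h0 : 0 ≤ θ) (h1 : θ ^ 2 ≤ 11 / 10)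
    (hθ : θ < Real.pi) :
    mulCotPolyPrimitive (26 / 10 ^ 7) θ ≤ ∫ t in (0:ℝ)..θ, mulCot t ∧
      ∫ t in (0:ℝ)..θ, mulCot t ≤ mulCotPolyPrimitive (1382 / 638512875) θ := by
  have hint (c : ℝ) : IntervalIntegrable (mulCotPoly c) MeasureTheory.volume 0 θ := by
    refine Continuous.intervalIntegrable ?_ _ _
    unfold mulCotPoly
    fun_prop
  have hsq {t : ℝ} (ht : t ∈ Set.Icc 0 θ) : t ^ 2 ≤ 11 / 10 :=
    (pow_le_pow_left₀ ht.1 ht.2 2).trans h1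
  have hcot := intervalIntegrable_mulCot h0 hθ
  rw [← integral_mulCotPoly, ← integral_mulCotPoly]
  exact ⟨intervalIntegral.integral_mono_on h0 (hint _) hcot fun t ht =>
      le_mulCot ht.1 (hsq ht) (ht.2.trans_lt hθ),
    intervalIntegral.integral_mono_on h0 hcot (hint _) fun t ht =>
      mulCot_le ht.1 (hsq ht) (ht.2.trans_lt hθ)⟩

/-- `1.014941 < v_tet < 1.014942`. -/
theorem stmt_2 : 1.014941 < vtet ∧ vtet < 1.014942 := by
  have h1 := Real.pi_gt_d20
  have h2 := Real.pi_lt_d20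
  have hθ0 : 0 ≤ Real.pi / 3 := by linarith
  have hlo : (1.04719755119 : ℝ) ≤ Real.pi / 3 := by linarith
  have hhi : Real.pi / 3 ≤ (1.0471975512 : ℝ) := by linarith
  obtain ⟨hL, hU⟩ := mulCotPolyPrimitive_le_integral_mulCot hθ0
    ((pow_le_pow_left₀ hθ0 hhi 2).trans (by norm_num)) (by linarith)
  have hlog1 := Real.log_three_gt_d9
  have hlog2 := Real.log_three_lt_d9
  have hpow (n : ℕ) := And.intro (pow_le_pow_left₀ (by norm_num) hlo n)
    (pow_le_pow_left₀ hθ0 hhi n)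
  have hmul1 : (3.14159265357 / 2 : ℝ) * 1.0986122885 ≤ Real.pi / 2 * Real.log 3 := by
    gcongr
    linarith
  have hmul2 : Real.pi / 2 * Real.log 3 ≤ (3.1415926536 / 2 : ℝ) * 1.0986122888 := by
    gcongr
    · linarith
  obtain ⟨l3, u3⟩ := hpow 3
  obtain ⟨l5, u5⟩ := hpow 5
  obtain ⟨l7, u7⟩ := hpow 7
  obtain ⟨l9, u9⟩ := hpow 9
  obtain ⟨l11, u11⟩ := hpow 11
  obtain ⟨l13, u13⟩ := hpow 13
  rw [vtet_eq]
  unfold mulCotPolyPrimitive at hL hU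
  constructor <;> linarith
end

section
/- (Arithmetic core of Theorem 1.) Let γ be a real number with γ > 1 and γ^5 = (γ+1)^2, let v_tet = 3·Λ(π/3) where Λ(θ) = -∫_0^θ log(2 sin t) dt, and let ξ = exp(5·v_tet/π). Let vol, d, t, c be real numbers with t > 8. If d > 2·γ^(t-1) + 2·(c - t)·γ^((t-3)/2) (Ito's determinant bound), vol ≤ 10·v_tet·(t - 1.4) (the Vesnin–Egorov volume bound), and c ≥ t + ξ^(t-1.4)/(2·γ^((t-3)/2)) - γ^((t+1)/2), then vol < 2π·log d. -/
/-- Burton's constant `ξ = exp(5 v_tet / π)`. -/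
noncomputable def xiBurton : ℝ := Real.exp (5 * vtet / Real.pi)

/-- Arithmetic core of Theorem 1: Ito's determinant bound, the Vesnin–Egorov volume
bound and the crossing-number hypothesis imply the Vol-Det inequality. -/
theorem stmt_6 (γ vol d t c : ℝ) (hγ : 1 < γ) (hγ5 : γ ^ 5 = (γ + 1) ^ 2)
    (ht : t > 8)
    (hd : d > 2 * γ ^ (t - 1) + 2 * (c - t) * γ ^ ((t - 3) / 2))
    (hvol : vol ≤ 10 * vtet * (t - 1.4))
    (hc : c ≥ t + xiBurton ^ (t - 1.4) / (2 * γ ^ ((t - 3) / 2)) - γ ^ ((t + 1) / 2)) :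
    vol < 2 * Real.pi * Real.log d := by
  have hγ0 : 0 < γ := by linarith
  have hq : 0 < γ ^ ((t - 3) / 2) := Real.rpow_pos_of_pos hγ0 _
  have hmul : γ ^ ((t + 1) / 2) * γ ^ ((t - 3) / 2) = γ ^ (t - 1) := by
    rw [← Real.rpow_add hγ0]
    ring_nf
  have hdiv : xiBurton ^ (t - 1.4) / (2 * γ ^ ((t - 3) / 2)) * (2 * γ ^ ((t - 3) / 2)) =
      xiBurton ^ (t - 1.4) := div_mul_cancel₀ _ (by positivity)
  have hd' : xiBurton ^ (t - 1.4) < d := by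
    have h := mul_le_mul_of_nonneg_right hc (by positivity : 0 ≤ 2 * γ ^ ((t - 3) / 2))
    linarith
  have hξ : 0 < xiBurton := Real.exp_pos _
  have hlog := Real.log_lt_log (Real.rpow_pos_of_pos hξ _) hd'
  rw [Real.log_rpow hξ, xiBurton, Real.log_exp] at hlog
  calc vol ≤ 10 * vtet * (t - 1.4) := hvol
    _ = 2 * Real.pi * ((t - 1.4) * (5 * vtet / Real.pi)) := by
      field_simp
      ring
    _ < 2 * Real.pi * Real.log d := mul_lt_mul_of_pos_left hlog Real.two_pi_pos
end

section
/- (Arithmetic core of the Remark 3 variant of Theorem 3.) Let v_tet = 3·Λ(π/3) where Λ(θ) = -∫_0^θ log(2 sin t) dt, let φ = (1+√5)/2, and let F_n denote the n-th Fibonacci number. Let t be a natural number with t ≥ 9 and let vol, d be real numbers. If d ≥ (8/17)·F_{t+3} and vol ≤ 10·v_tet·(t - 1.4), then vol ≤ A·log(d + D') - E', where A = 10·v_tet/log φ, D' = (8/(17·√5))·((√5-1)/2)^12, and E' = 44·v_tet + (10·v_tet·log(8/(17·√5)))/log φ. -/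
open Real in
/-- The logarithm splits over the integration range even at `0`, which the half-open interval
leaves out. -/
lemma log_two_mul_sin_eqOn {a b : ℝ} (ha : 0 ≤ a) (hab : a ≤ b) (hb : b ≤ π / 2) :
    Set.EqOn (fun t => log 2 + log (sin t)) (fun t => log (2 * sin t)) (Set.uIoc a b) := by
  intro t ht
  rw [Set.uIoc_of_le hab] at ht
  have hsin : 0 < sin t :=
    sin_pos_of_pos_of_lt_pi (ha.trans_lt ht.1) (by linarith [ht.2, pi_pos])
  exact (log_mul two_ne_zero hsin.ne').symm

open Real MeasureTheory in
lemma intervalIntegrable_log_two_mul_sin_s11 {a b : ℝ} (ha : 0 ≤ a) (hab : a ≤ b)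
    (hb : b ≤ π / 2) : IntervalIntegrable (fun t => log (2 * sin t)) volume a b :=
  (intervalIntegrable_const.add intervalIntegrable_log_sin).congr
    (log_two_mul_sin_eqOn ha hab hb)

open Real in
lemma lob_pi_div_two : lob (π / 2) = 0 := by
  have hpi := pi_pos
  rw [lob, ← intervalIntegral.integral_congr_ae
      (Filter.Eventually.of_forall (log_two_mul_sin_eqOn le_rfl (by positivity) le_rfl)),
    intervalIntegral.integral_add intervalIntegrable_const (by apply intervalIntegrable_log_sin),
    integral_log_sin_zero_pi_div_two, intervalIntegral.integral_const, smul_eq_mul]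
  ring

open Real in
lemma lob_pi_div_three_nonneg : 0 ≤ lob (π / 3) := by
  have hpi := pi_pos
  have hle : π / 3 ≤ π / 2 := by linarith
  have hsplit := intervalIntegral.integral_add_adjacent_intervals
    (intervalIntegrable_log_two_mul_sin_s11 le_rfl (by positivity) hle)
    (intervalIntegrable_log_two_mul_sin_s11 (by positivity) hle le_rfl)
  have hnonneg : 0 ≤ ∫ t in (π / 3)..(π / 2), log (2 * sin t) := by
    refine intervalIntegral.integral_nonneg hle fun t ht => log_nonneg ?_
    have hsin : sin (π / 6) ≤ sin t :=
      sin_le_sin_of_le_of_le_pi_div_two (by linarith) ht.2 (by linarith [ht.1])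
    rw [sin_pi_div_six] at hsin
    linarith
  have hzero := lob_pi_div_two
  rw [lob] at hzero ⊢
  linarith

lemma vtet_nonneg : 0 ≤ vtet :=
  mul_nonneg zero_le_three lob_pi_div_three_nonneg

open Real goldenRatio in
/-- Binet's formula bounds `φ ^ n` by the Fibonacci number up to a fixed power of the conjugate. -/
lemma goldenRatio_pow_le_fib_add {m n : ℕ} (hmn : m ≤ n) :
    φ ^ n / √5 ≤ Nat.fib n + (-ψ) ^ m / √5 := by
  have hψ : ψ ^ n ≤ (-ψ) ^ m := calc
    ψ ^ n ≤ |ψ ^ n| := le_abs_self _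
    _ = (-ψ) ^ n := by rw [abs_pow, abs_of_neg goldenConj_neg]
    _ ≤ (-ψ) ^ m := pow_le_pow_of_le_one (by linarith [goldenConj_neg])
      (by linarith [neg_one_lt_goldenConj]) hmn
  rw [coe_fib_eq, ← add_div]
  gcongr
  linarith

/-- Arithmetic core of the Remark 3 variant of Theorem 3. -/
theorem stmt_11 (t : ℕ) (ht : 9 ≤ t) (vol d : ℝ)
    (hd : d ≥ (8 / 17 : ℝ) * Nat.fib (t + 3))
    (hvol : vol ≤ 10 * vtet * ((t : ℝ) - 1.4)) :
    vol ≤ (10 * vtet / Real.log ((1 + Real.sqrt 5) / 2))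
            * Real.log (d + (8 / (17 * Real.sqrt 5)) * ((Real.sqrt 5 - 1) / 2) ^ 12)
          - (44 * vtet + (10 * vtet * Real.log (8 / (17 * Real.sqrt 5)))
              / Real.log ((1 + Real.sqrt 5) / 2)) := by
  have hφ : 0 < Real.log ((1 + √5) / 2) := Real.log_pos Real.one_lt_goldenRatio
  have hφ' : 0 < (1 + √5) / 2 := Real.goldenRatio_pos
  have hbinet := goldenRatio_pow_le_fib_add (show 12 ≤ t + 3 by lia)
  have hd' : 8 / (17 * √5) * ((1 + √5) / 2) ^ (t + 3)
      ≤ d + 8 / (17 * √5) * ((√5 - 1) / 2) ^ 12 := calc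
    _ = 8 / 17 * (((1 + √5) / 2) ^ (t + 3) / √5) := by field_simp
    _ ≤ 8 / 17 * (Nat.fib (t + 3) + (-((1 - √5) / 2)) ^ 12 / √5) := by gcongr
    _ = 8 / 17 * Nat.fib (t + 3) + 8 / (17 * √5) * ((√5 - 1) / 2) ^ 12 := by
      rw [show -((1 - √5) / 2) = (√5 - 1) / 2 by ring, mul_add]
      congr 1
      field_simp
    _ ≤ _ := by gcongr
  have hlog := Real.log_le_log (by positivity) hd'
  rw [Real.log_mul (by positivity) (by positivity), Real.log_pow] at hlog
  push_cast at hlog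
  have hv := vtet_nonneg
  calc vol ≤ 10 * vtet * ((t : ℝ) - 1.4) := hvol
    _ = 10 * vtet / Real.log ((1 + √5) / 2) *
          (Real.log (8 / (17 * √5)) + (t + 3) * Real.log ((1 + √5) / 2))
        - (44 * vtet + 10 * vtet * Real.log (8 / (17 * √5)) / Real.log ((1 + √5) / 2)) := by
      field_simp
      ring
    _ ≤ _ := by gcongr
end
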